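/- arXiv:2006.01468 — 3 statements merged into one kernel-verified Lean document; each statement's English description precedes it below -/
import Mathlib

section
/- For n₁, n₂, n₃ ∈ ℕ with n₄ := n₁ + n₃ - n₂ ≥ 0, the projection of the product φ_{n₁} φ̄_{n₂} φ_{n₃} onto the Bargmann-Fock space equals (1/(2π)) · (n₁+n₃)! / (2^{n₁+n₃} √(n₁! n₂! n₃! n₄!)) · φ_{n₄}; if n₁ + n₃ - n₂ < 0 the projection is zero. -/
open MeasureTheory Complex

noncomputable section

/-- The LLL projection Π given by its integral kernel. -/
def Proj (u : ℂ → ℂ) (z : ℂ) : ℂ :=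
  (Real.pi : ℂ)⁻¹ * Complex.exp (-((‖z‖ ^ 2 : ℝ) : ℂ) / 2) *
    ∫ w : ℂ, Complex.exp ((starRingEnd ℂ) w * z - ((‖w‖ ^ 2 : ℝ) : ℂ) / 2) * u w

/-- The special Hermite functions φₙ(z) = zⁿ e^{-|z|²/2}/√(π n!). -/
def phi (n : ℕ) (z : ℂ) : ℂ :=
  ((Real.sqrt (Real.pi * n.factorial))⁻¹ : ℝ) * z ^ n *
    Complex.exp (-((‖z‖ ^ 2 : ℝ) : ℂ) / 2)

/-- The absolute Gaussian moments `∫ |w|^N e^{-b|w|²}` on the complex plane. -/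
theorem integral_norm_pow_mul_exp (N : ℕ) {b : ℝ} (hb : 0 < b) :
    ∫ w : ℂ, ‖w‖ ^ N * Real.exp (-b * ‖w‖ ^ 2) =
      Real.pi * b ^ (-((N : ℝ) + 2) / 2) * Real.Gamma (((N : ℝ) + 2) / 2) := by
  have h := Complex.integral_rpow_mul_exp_neg_mul_rpow (p := 2) (q := N) (b := b)
    (by norm_num) (by linarith [Nat.cast_nonneg (α := ℝ) N]) hb
  simpa [Real.rpow_natCast] using h

theorem integrable_norm_pow_mul_exp (N : ℕ) {b : ℝ} (hb : 0 < b) :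
    Integrable fun w : ℂ => ‖w‖ ^ N * Real.exp (-b * ‖w‖ ^ 2) := by
  apply Integrable.of_integral_ne_zero
  rw [integral_norm_pow_mul_exp N hb]
  have := Real.Gamma_pos_of_pos (s := ((N : ℝ) + 2) / 2) (by positivity)
  positivity

theorem integral_pow_mul_conj_pow_self (m : ℕ) :
    ∫ w : ℂ, w ^ m * (starRingEnd ℂ) w ^ m * ((Real.exp (-2 * ‖w‖ ^ 2) : ℝ) : ℂ) =
      ((Real.pi * m.factorial / 2 ^ (m + 1) : ℝ) : ℂ) := by
  have h := integral_norm_pow_mul_exp (2 * m) (b := 2) (by norm_num)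
  have e : ((2 * m : ℕ) + 2 : ℝ) / 2 = m + 1 := by push_cast; ring
  rw [neg_div, e, Real.Gamma_nat_eq_factorial, Real.rpow_neg (by norm_num)] at h
  norm_cast at h
  have h' : ∀ w : ℂ, w ^ m * (starRingEnd ℂ) w ^ m * ((Real.exp (-2 * ‖w‖ ^ 2) : ℝ) : ℂ) =
      ((‖w‖ ^ (2 * m) * Real.exp (-2 * ‖w‖ ^ 2) : ℝ) : ℂ) := by
    intro w
    rw [← mul_pow, Complex.mul_conj, Complex.normSq_eq_norm_sq]
    push_cast
    rw [pow_mul]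
  simp_rw [h']
  rw [integral_complex_ofReal]
  congr 1
  refine Eq.trans ?_ (h.trans ?_)
  · norm_num
  · push_cast; ring

theorem integral_pow_mul_conj_pow_of_ne {a b : ℕ} (hab : a ≠ b) :
    ∫ w : ℂ, w ^ a * (starRingEnd ℂ) w ^ b * ((Real.exp (-2 * ‖w‖ ^ 2) : ℝ) : ℂ) = 0 := by
  have hab' : (a : ℝ) - b ≠ 0 := sub_ne_zero.mpr (by exact_mod_cast hab)
  set c : Circle := Circle.exp (Real.pi / (a - b)) with hc
  have hrot : (c : ℂ) ^ a * (starRingEnd ℂ) (c : ℂ) ^ b = -1 := by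
    rw [hc, Circle.coe_exp, ← Complex.exp_conj, ← Complex.exp_nat_mul, ← Complex.exp_nat_mul,
      ← Complex.exp_add, ← Complex.exp_pi_mul_I]
    congr 1
    have : (a : ℂ) - b ≠ 0 := by exact_mod_cast hab'
    simp
    field_simp
    ring
  have h := (rotation c).measurePreserving.integral_comp
    (rotation c).toHomeomorph.measurableEmbedding
    (fun w : ℂ => w ^ a * (starRingEnd ℂ) w ^ b * ((Real.exp (-2 * ‖w‖ ^ 2) : ℝ) : ℂ))
  have h' : ∀ w : ℂ, (rotation c w) ^ a * (starRingEnd ℂ) (rotation c w) ^ b *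
      ((Real.exp (-2 * ‖rotation c w‖ ^ 2) : ℝ) : ℂ) =
      -(w ^ a * (starRingEnd ℂ) w ^ b * ((Real.exp (-2 * ‖w‖ ^ 2) : ℝ) : ℂ)) := by
    intro w
    rw [LinearIsometryEquiv.norm_map, rotation_apply, map_mul, mul_pow, mul_pow]
    linear_combination (w ^ a * (starRingEnd ℂ) w ^ b *
      ((Real.exp (-2 * ‖w‖ ^ 2) : ℝ) : ℂ)) * hrot
  simp_rw [h'] at h
  rw [integral_neg] at h
  exact self_eq_neg.mp h.symm

theorem hasSum_integral_exp_conj_mul (m n : ℕ) (z : ℂ) :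
    HasSum (fun k : ℕ => z ^ k / k.factorial *
        ∫ w : ℂ, w ^ m * (starRingEnd ℂ) w ^ (n + k) * ((Real.exp (-2 * ‖w‖ ^ 2) : ℝ) : ℂ))
      (∫ w : ℂ, Complex.exp ((starRingEnd ℂ) w * z) * (w ^ m * (starRingEnd ℂ) w ^ n *
        ((Real.exp (-2 * ‖w‖ ^ 2) : ℝ) : ℂ))) := by
  have hexp (w : ℂ) : HasSum (fun k : ℕ => (‖w‖ * ‖z‖) ^ k / k.factorial *
      (‖w‖ ^ (m + n) * Real.exp (-2 * ‖w‖ ^ 2)))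
      (Real.exp (‖w‖ * ‖z‖) * (‖w‖ ^ (m + n) * Real.exp (-2 * ‖w‖ ^ 2))) := by
    rw [Real.exp_eq_exp_ℝ]
    exact (NormedSpace.expSeries_div_hasSum_exp (𝔸 := ℝ) (‖w‖ * ‖z‖)).mul_right _
  have hexp' (w : ℂ) : HasSum (fun k : ℕ => ((starRingEnd ℂ) w * z) ^ k / k.factorial *
      (w ^ m * (starRingEnd ℂ) w ^ n * ((Real.exp (-2 * ‖w‖ ^ 2) : ℝ) : ℂ)))
      (Complex.exp ((starRingEnd ℂ) w * z) *
        (w ^ m * (starRingEnd ℂ) w ^ n * ((Real.exp (-2 * ‖w‖ ^ 2) : ℝ) : ℂ))) := by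
    rw [Complex.exp_eq_exp_ℂ]
    exact (NormedSpace.expSeries_div_hasSum_exp (𝔸 := ℂ) ((starRingEnd ℂ) w * z)).mul_right _
  have key := hasSum_integral_of_dominated_convergence (μ := (volume : Measure ℂ))
    (F := fun (k : ℕ) (w : ℂ) => ((starRingEnd ℂ) w * z) ^ k / k.factorial *
      (w ^ m * (starRingEnd ℂ) w ^ n * ((Real.exp (-2 * ‖w‖ ^ 2) : ℝ) : ℂ)))
    (fun (k : ℕ) (w : ℂ) => (‖w‖ * ‖z‖) ^ k / k.factorial *
      (‖w‖ ^ (m + n) * Real.exp (-2 * ‖w‖ ^ 2)))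
    (fun k => by
      have : Continuous fun w : ℂ => (starRingEnd ℂ) w := Complex.continuous_conj
      exact Continuous.aestronglyMeasurable (by fun_prop))
    (fun k => .of_forall fun w => by
      simp [abs_of_pos (Real.exp_pos _), pow_add, -Complex.ofReal_exp])
    (.of_forall fun w => (hexp w).summable)
    (by
      simp_rw [fun w => (hexp w).tsum_eq]
      refine ((integrable_norm_pow_mul_exp (m + n) one_pos).const_mul
        (Real.exp (‖z‖ ^ 2 / 4))).mono' (Continuous.aestronglyMeasurable (by fun_prop))
        (.of_forall fun w => ?_)
      rw [Real.norm_of_nonneg (by positivity), mul_left_comm, mul_left_comm (Real.exp _),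
        ← Real.exp_add, ← Real.exp_add]
      refine mul_le_mul_of_nonneg_left (Real.exp_le_exp.mpr ?_) (by positivity)
      nlinarith [sq_nonneg (‖w‖ - ‖z‖ / 2)])
    (.of_forall hexp')
  refine key.congr_fun fun k => ?_
  rw [← integral_const_mul]
  congr 1 with w
  rw [mul_pow, pow_add]
  ring

theorem proj_phi_mul_conj_phi_mul_phi (n₁ n₂ n₃ : ℕ) (z : ℂ) :
    Proj (fun w => phi n₁ w * (starRingEnd ℂ) (phi n₂ w) * phi n₃ w) z =
      (Real.pi : ℂ)⁻¹ * Complex.exp (-((‖z‖ ^ 2 : ℝ) : ℂ) / 2) *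
        ((((Real.sqrt (Real.pi * n₁.factorial))⁻¹ * (Real.sqrt (Real.pi * n₂.factorial))⁻¹ *
            (Real.sqrt (Real.pi * n₃.factorial))⁻¹ : ℝ) : ℂ) *
          ∫ w : ℂ, Complex.exp ((starRingEnd ℂ) w * z) * (w ^ (n₁ + n₃) * (starRingEnd ℂ) w ^ n₂ *
            ((Real.exp (-2 * ‖w‖ ^ 2) : ℝ) : ℂ))) := by
  rw [Proj]
  congr 1
  rw [← integral_const_mul]
  congr 1 with w
  have hg : ((Real.exp (-2 * ‖w‖ ^ 2) : ℝ) : ℂ) =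
      Complex.exp (-((‖w‖ ^ 2 : ℝ) : ℂ) / 2) ^ 4 := by
    rw [← Complex.exp_nat_mul, Complex.ofReal_exp]
    congr 1
    push_cast
    ring
  have hc : (starRingEnd ℂ) (Complex.exp (-((‖w‖ ^ 2 : ℝ) : ℂ) / 2)) =
      Complex.exp (-((‖w‖ ^ 2 : ℝ) : ℂ) / 2) := by
    rw [← Complex.exp_conj]
    simp [Complex.conj_ofNat]
  simp only [phi, map_mul, map_pow, Complex.conj_ofReal]
  rw [hc, hg, sub_eq_add_neg, Complex.exp_add, ← neg_div, pow_add]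
  push_cast
  ring

/-- Product rule: Π(φ_{n₁} φ̄_{n₂} φ_{n₃}) = c φ_{n₁+n₃-n₂} if n₁+n₃ ≥ n₂, and 0 otherwise. -/
theorem stmt1 (n₁ n₂ n₃ : ℕ) :
    (n₂ ≤ n₁ + n₃ →
      ∀ z : ℂ, Proj (fun w => phi n₁ w * (starRingEnd ℂ) (phi n₂ w) * phi n₃ w) z
        = (((1 / (2 * Real.pi)) * ((n₁ + n₃).factorial /
            (2 ^ (n₁ + n₃) * Real.sqrt (n₁.factorial * n₂.factorial * n₃.factorial *
              (n₁ + n₃ - n₂).factorial))) : ℝ) : ℂ) * phi (n₁ + n₃ - n₂) z)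
    ∧ (n₁ + n₃ < n₂ →
      ∀ z : ℂ, Proj (fun w => phi n₁ w * (starRingEnd ℂ) (phi n₂ w) * phi n₃ w) z = 0) := by
  simp_rw [proj_phi_mul_conj_phi_mul_phi]
  refine ⟨fun h z => ?_, fun h z => ?_⟩
  · have hs := (hasSum_integral_exp_conj_mul (n₁ + n₃) n₂ z).unique
      (hasSum_single (n₁ + n₃ - n₂) fun k hk => by
        rw [integral_pow_mul_conj_pow_of_ne (by omega), mul_zero])
    rw [hs, Nat.add_sub_cancel' h, integral_pow_mul_conj_pow_self, phi]
    set m := n₁ + n₃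
    set d := m - n₂
    have hd : (d.factorial : ℝ) = Real.sqrt d.factorial ^ 2 := (Real.sq_sqrt (by positivity)).symm
    have hpi : Real.pi = Real.sqrt Real.pi ^ 2 := (Real.sq_sqrt (by positivity)).symm
    have hcoef : Real.pi⁻¹ * ((Real.sqrt (Real.pi * n₁.factorial))⁻¹ *
          (Real.sqrt (Real.pi * n₂.factorial))⁻¹ * (Real.sqrt (Real.pi * n₃.factorial))⁻¹) *
          ((d.factorial : ℝ)⁻¹ * (Real.pi * m.factorial / 2 ^ (m + 1))) =
        1 / (2 * Real.pi) * (m.factorial / (2 ^ m * Real.sqrt (n₁.factorial * n₂.factorial *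
          n₃.factorial * d.factorial))) * (Real.sqrt (Real.pi * d.factorial))⁻¹ := by
      rw [Real.sqrt_mul (by positivity), Real.sqrt_mul (by positivity),
        Real.sqrt_mul (by positivity), Real.sqrt_mul (by positivity),
        Real.sqrt_mul (by positivity), Real.sqrt_mul (by positivity),
        Real.sqrt_mul (by positivity)]
      have h0 : 0 < Real.sqrt Real.pi := by positivity
      have h1 : 0 < Real.sqrt d.factorial := by positivity
      generalize Real.sqrt d.factorial = x at *
      generalize Real.sqrt Real.pi = p at *
      rw [hd, hpi]
      field_simp
      ring
    have hcoef' := congrArg (fun x : ℝ => (x : ℂ)) hcoef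
    push_cast at hcoef' ⊢
    linear_combination (z ^ d * Complex.exp (-(‖z‖ : ℂ) ^ 2 / 2)) * hcoef'
  · have hs := (hasSum_integral_exp_conj_mul (n₁ + n₃) n₂ z).unique
      (hasSum_zero.congr_fun fun k => by
        rw [integral_pow_mul_conj_pow_of_ne (by omega), mul_zero])
    rw [hs, mul_zero, mul_zero]
end
end

section
/- Let u ∈ Ẽ with u = f e^{-|z|²/2}. For all integers n, m, j, k ≥ 0 there exists C > 0 such that for all 1 ≤ p ≤ ∞ and all u, v ∈ Ẽ, ‖z^{n+m} ∂_{z̄}^j ∂_z^k (u v̄)‖_{L^p(ℂ)} ≤ C (‖u‖_{L^{2p}} + ‖zⁿu‖_{L^{2p}}) (‖v‖_{L^{2p}} + ‖z^m v‖_{L^{2p}}). In particular ‖∂_{z̄}^j ∂_z^k(|v|²)‖_{L^p(ℂ)} ≤ C ‖v‖²_{L^{2p}(ℂ)}. -/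
open MeasureTheory Complex ENNReal

noncomputable section

/-- Wirtinger derivative ∂_z = (∂_x - i ∂_y)/2. -/
def wd (f : ℂ → ℂ) (z : ℂ) : ℂ :=
  (fderiv ℝ f z 1 - Complex.I • fderiv ℝ f z Complex.I) / 2

/-- Wirtinger derivative ∂_z̄ = (∂_x + i ∂_y)/2. -/
def wdb (f : ℂ → ℂ) (z : ℂ) : ℂ :=
  (fderiv ℝ f z 1 + Complex.I • fderiv ℝ f z Complex.I) / 2

/-- Membership in the enlarged Bargmann-Fock space Ẽ. -/
def tildeE (u : ℂ → ℂ) : Prop :=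
  ∃ f : ℂ → ℂ, Differentiable ℂ f ∧
    ∀ z, u z = f z * Complex.exp (-((‖z‖ ^ 2 : ℝ) : ℂ) / 2)

/-- The uniform probability measure on the angles `(0, 2π]`. -/
def angleMeasure : Measure ℝ :=
  (ENNReal.ofReal (2 * Real.pi))⁻¹ • volume.restrict (Set.Ioc 0 (2 * Real.pi))

instance isProbabilityMeasure_angleMeasure : IsProbabilityMeasure angleMeasure := by
  constructor
  have h : (0 : ℝ) < 2 * Real.pi := by positivity
  simp only [angleMeasure, Measure.smul_apply, Measure.restrict_apply MeasurableSet.univ,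
    Set.univ_inter, Real.volume_Ioc, sub_zero, smul_eq_mul]
  exact ENNReal.inv_mul_cancel (by simpa using h) ENNReal.ofReal_ne_top

lemma integral_angleMeasure (f : ℝ → ℝ) :
    ∫ θ, f θ ∂angleMeasure = (2 * Real.pi)⁻¹ * ∫ θ in 0..2 * Real.pi, f θ := by
  have h : (0 : ℝ) < 2 * Real.pi := by positivity
  rw [angleMeasure, integral_smul_measure, intervalIntegral.integral_of_le h.le,
    ENNReal.toReal_inv, ENNReal.toReal_ofReal h.le, smul_eq_mul]

lemma Continuous.integrable_angleMeasure {f : ℝ → ℝ} (hf : Continuous f) :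
    Integrable f angleMeasure := by
  have h : (0 : ℝ) < 2 * Real.pi := by positivity
  refine Integrable.smul_measure ?_ (by simpa using h)
  exact (hf.integrableOn_Icc (a := 0) (b := 2 * Real.pi)).mono_set Set.Ioc_subset_Icc_self

/-- Cauchy's estimate on the unit circle, in terms of an average. -/
lemma norm_iteratedDeriv_le_average {φ : ℂ → ℂ} (hφ : Differentiable ℂ φ) (k : ℕ) (z : ℂ) :
    ‖iteratedDeriv k φ z‖ ≤
      k.factorial * ∫ θ, ‖φ (z + circleMap 0 1 θ)‖ ∂angleMeasure := by
  have h1 := hφ.hasFPowerSeriesOnBall z (R := 1) one_pos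
  have h2 := h1.factorial_smul 1 k
  rw [← iteratedDeriv_eq_iteratedFDeriv] at h2
  have h3 : ‖(cauchyPowerSeries φ z (1 : NNReal) k) fun _ => (1 : ℂ)‖ ≤
      ‖cauchyPowerSeries φ z (1 : NNReal) k‖ := by
    simp
  have h4 := norm_cauchyPowerSeries_le φ z 1 k
  rw [← h2, ← Nat.cast_smul_eq_nsmul ℂ, norm_smul, integral_angleMeasure]
  have h5 : ∀ θ, z + circleMap 0 1 θ = circleMap z 1 θ := by intro θ; simp [circleMap]
  simp only [h5]
  simp only [abs_one, inv_one, one_pow, mul_one] at h4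
  simp only [NNReal.coe_one] at h3
  simp only [NNReal.coe_one, norm_natCast]
  gcongr
  exact h3.trans h4

/-- Translation averages contract every `L^q` norm, `1 ≤ q ≤ ∞`. -/
lemma eLpNorm_average_translate_le {U : ℂ → ℝ} (hU : Continuous U) {τ : ℝ → ℂ}
    (hτ : Continuous τ) {q : ℝ≥0∞} (hq : 1 ≤ q) :
    eLpNorm (fun z => ∫ θ, U (z + τ θ) ∂angleMeasure) q volume ≤ eLpNorm U q volume := by
  have key : ∀ z, ‖∫ θ, U (z + τ θ) ∂angleMeasure‖ₑ ≤
      eLpNorm (fun θ => U (z + τ θ)) q angleMeasure := fun z => by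
    refine (enorm_integral_le_lintegral_enorm _).trans ?_
    rw [← eLpNorm_one_eq_lintegral_enorm]
    exact eLpNorm_le_eLpNorm_of_exponent_le hq
      (by fun_prop : Continuous fun θ => U (z + τ θ)).aestronglyMeasurable
  rcases eq_or_ne q ∞ with rfl | hq'
  · have hbd : ∀ z, ‖U z‖ₑ ≤ eLpNorm U ∞ volume := by
      have hae : ∀ᵐ z, ‖U z‖ₑ ≤ eLpNorm U ∞ volume := by
        simpa [eLpNorm_exponent_top] using enorm_ae_le_eLpNormEssSup U volume
      have hopen : IsOpen {z | ¬ ‖U z‖ₑ ≤ eLpNorm U ∞ volume} := by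
        simpa only [not_le] using isOpen_lt continuous_const hU.enorm
      have := (hopen.measure_eq_zero_iff volume).1 hae
      intro z
      by_contra hz
      exact (this ▸ hz : z ∈ (∅ : Set ℂ))
    rw [eLpNorm_exponent_top]
    refine eLpNormEssSup_le_of_ae_enorm_bound (Filter.Eventually.of_forall fun z => ?_)
    refine (key z).trans ?_
    rw [eLpNorm_exponent_top]
    exact eLpNormEssSup_le_of_ae_enorm_bound (Filter.Eventually.of_forall fun θ => hbd _)
  · have hq0 : q ≠ 0 := (zero_lt_one.trans_le hq).ne'
    have hr : 0 < q.toReal := ENNReal.toReal_pos hq0 hq'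
    simp only [eLpNorm_eq_lintegral_rpow_enorm_toReal hq0 hq'] at key ⊢
    gcongr ?_ ^ _
    calc ∫⁻ z, ‖∫ θ, U (z + τ θ) ∂angleMeasure‖ₑ ^ q.toReal
        ≤ ∫⁻ z, ∫⁻ θ, ‖U (z + τ θ)‖ₑ ^ q.toReal ∂angleMeasure := by
          refine lintegral_mono fun z => ?_
          refine (ENNReal.rpow_le_rpow (key z) hr.le).trans ?_
          rw [← ENNReal.rpow_mul, one_div, inv_mul_cancel₀ hr.ne', ENNReal.rpow_one]
      _ = ∫⁻ θ, (∫⁻ z, ‖U (z + τ θ)‖ₑ ^ q.toReal) ∂angleMeasure := by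
          refine lintegral_lintegral_swap ?_
          refine Measurable.aemeasurable ?_
          have : Continuous fun p : ℂ × ℝ => U (p.1 + τ p.2) := by fun_prop
          exact this.measurable.enorm.pow_const _
      _ = ∫⁻ z, ‖U z‖ₑ ^ q.toReal := by
          simp [lintegral_add_right_eq_self (fun z => ‖U z‖ₑ ^ q.toReal)]

/-- The derivative of `H : ℂ × ℂ → ℂ` in the direction `e`. -/
def dirDeriv (e : ℂ × ℂ) (H : ℂ × ℂ → ℂ) (p : ℂ × ℂ) : ℂ := fderiv ℂ H p e

lemma ContDiff.dirDeriv {H : ℂ × ℂ → ℂ} (hH : ContDiff ℂ (⊤ : ℕ∞) H) (e : ℂ × ℂ) :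
    ContDiff ℂ (⊤ : ℕ∞) (dirDeriv e H) :=
  (hH.fderiv_right (m := (⊤ : ℕ∞)) (by simp)).clm_apply contDiff_const

lemma ContDiff.iterate_dirDeriv {H : ℂ × ℂ → ℂ} (hH : ContDiff ℂ (⊤ : ℕ∞) H) (e : ℂ × ℂ)
    (k : ℕ) : ContDiff ℂ (⊤ : ℕ∞) ((_root_.dirDeriv e)^[k] H) := by
  induction k with
  | zero => exact hH
  | succ k ih => rw [Function.iterate_succ_apply']; exact ih.dirDeriv e

lemma fderiv_antidiagonal {H : ℂ × ℂ → ℂ} (hH : ContDiff ℂ (⊤ : ℕ∞) H) (z v : ℂ) :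
    fderiv ℝ (fun w => H (w, (starRingEnd ℂ) w)) z v =
      fderiv ℂ H (z, (starRingEnd ℂ) z) (v, (starRingEnd ℂ) v) := by
  have h1 : HasFDerivAt H ((fderiv ℂ H (z, (starRingEnd ℂ) z)).restrictScalars ℝ)
      (z, (starRingEnd ℂ) z) :=
    ((hH.differentiable (by simp)) _).hasFDerivAt.restrictScalars ℝ
  have h2 : HasFDerivAt (fun w : ℂ => (w, (starRingEnd ℂ) w))
      ((ContinuousLinearMap.id ℝ ℂ).prod (conjCLE : ℂ →L[ℝ] ℂ)) z :=
    (hasFDerivAt_id z).prodMk conjCLE.hasFDerivAt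
  have h3 : HasFDerivAt (fun w => H (w, (starRingEnd ℂ) w)) _ z := h1.comp z h2
  rw [h3.fderiv]
  simp

lemma wd_antidiagonal {H : ℂ × ℂ → ℂ} (hH : ContDiff ℂ (⊤ : ℕ∞) H) :
    wd (fun w => H (w, (starRingEnd ℂ) w)) =
      fun w => dirDeriv (1, 0) H (w, (starRingEnd ℂ) w) := by
  funext z
  simp only [wd, fderiv_antidiagonal hH, dirDeriv]
  rw [← map_smul, ← map_sub, div_eq_inv_mul, ← smul_eq_mul, ← map_smul]
  congr 1
  ext <;> simp
  norm_num

lemma wdb_antidiagonal {H : ℂ × ℂ → ℂ} (hH : ContDiff ℂ (⊤ : ℕ∞) H) :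
    wdb (fun w => H (w, (starRingEnd ℂ) w)) =
      fun w => dirDeriv (0, 1) H (w, (starRingEnd ℂ) w) := by
  funext z
  simp only [wdb, fderiv_antidiagonal hH, dirDeriv]
  rw [← map_smul, ← map_add, div_eq_inv_mul, ← smul_eq_mul, ← map_smul]
  congr 1
  ext <;> simp
  norm_num

lemma iterate_wd_antidiagonal {H : ℂ × ℂ → ℂ} (hH : ContDiff ℂ (⊤ : ℕ∞) H) (k : ℕ) :
    wd^[k] (fun w => H (w, (starRingEnd ℂ) w)) =
      fun w => (dirDeriv (1, 0))^[k] H (w, (starRingEnd ℂ) w) := by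
  induction k with
  | zero => rfl
  | succ k ih =>
    rw [Function.iterate_succ_apply', ih, wd_antidiagonal (hH.iterate_dirDeriv _ k),
      Function.iterate_succ_apply']

lemma iterate_wdb_antidiagonal {H : ℂ × ℂ → ℂ} (hH : ContDiff ℂ (⊤ : ℕ∞) H) (k : ℕ) :
    wdb^[k] (fun w => H (w, (starRingEnd ℂ) w)) =
      fun w => (dirDeriv (0, 1))^[k] H (w, (starRingEnd ℂ) w) := by
  induction k with
  | zero => rfl
  | succ k ih =>
    rw [Function.iterate_succ_apply', ih, wdb_antidiagonal (hH.iterate_dirDeriv _ k),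
      Function.iterate_succ_apply']

lemma iterate_dirDeriv_fst {H : ℂ × ℂ → ℂ} (hH : ContDiff ℂ (⊤ : ℕ∞) H) (k : ℕ) (t : ℂ) :
    (fun s => (dirDeriv (1, 0))^[k] H (s, t)) = iteratedDeriv k fun s => H (s, t) := by
  induction k with
  | zero => simp
  | succ k ih =>
    rw [iteratedDeriv_succ, ← ih, Function.iterate_succ_apply']
    funext s
    have h1 := (((hH.iterate_dirDeriv (1, 0) k).differentiable (by simp)) (s, t)).hasFDerivAt
    exact (h1.comp_hasDerivAt s ((hasDerivAt_id s).prodMk (hasDerivAt_const s t))).deriv.symm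

lemma iterate_dirDeriv_snd {H : ℂ × ℂ → ℂ} (hH : ContDiff ℂ (⊤ : ℕ∞) H) (k : ℕ) (s : ℂ) :
    (fun t => (dirDeriv (0, 1))^[k] H (s, t)) = iteratedDeriv k fun t => H (s, t) := by
  induction k with
  | zero => simp
  | succ k ih =>
    rw [iteratedDeriv_succ, ← ih, Function.iterate_succ_apply']
    funext t
    have h1 := (((hH.iterate_dirDeriv (0, 1) k).differentiable (by simp)) (s, t)).hasFDerivAt
    exact (h1.comp_hasDerivAt t ((hasDerivAt_const t s).prodMk (hasDerivAt_id t))).deriv.symm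

/-- Cauchy's estimate on the unit bidisc, for functions dominated by a product on its
distinguished boundary. -/
lemma norm_mixed_dirDeriv_le {H : ℂ × ℂ → ℂ} (hH : ContDiff ℂ (⊤ : ℕ∞) H) (j k : ℕ) (s t : ℂ)
    {K : ℝ} {A B : ℝ → ℝ} (hA : Continuous A) (hB : Continuous B)
    (hAB : ∀ θ η, ‖H (s + circleMap 0 1 θ, t + circleMap 0 1 η)‖ ≤ K * (A θ * B η)) :
    ‖(dirDeriv (0, 1))^[j] ((dirDeriv (1, 0))^[k] H) (s, t)‖ ≤
      (j.factorial * k.factorial * K) *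
        ((∫ θ, A θ ∂angleMeasure) * ∫ η, B η ∂angleMeasure) := by
  have hG := hH.iterate_dirDeriv (1, 0) k
  have hGt : Differentiable ℂ fun t => (dirDeriv (1, 0))^[k] H (s, t) :=
    (hG.differentiable (by simp)).comp (by fun_prop)
  have h1 := norm_iteratedDeriv_le_average hGt j t
  rw [← congrFun (iterate_dirDeriv_snd hG j s) t] at h1
  refine h1.trans ?_
  have h2 : ∀ η, ‖(dirDeriv (1, 0))^[k] H (s, t + circleMap 0 1 η)‖ ≤
      (k.factorial * K * ∫ θ, A θ ∂angleMeasure) * B η := fun η => by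
    have hHs : Differentiable ℂ fun s => H (s, t + circleMap 0 1 η) :=
      (hH.differentiable (by simp)).comp (by fun_prop)
    have h3 := norm_iteratedDeriv_le_average hHs k s
    rw [← congrFun (iterate_dirDeriv_fst hH k _) s] at h3
    refine h3.trans ?_
    have h4 : ∫ θ, ‖H (s + circleMap 0 1 θ, t + circleMap 0 1 η)‖ ∂angleMeasure ≤
        ∫ θ, K * B η * A θ ∂angleMeasure :=
      integral_mono_of_nonneg (Filter.Eventually.of_forall fun _ => norm_nonneg _)
        (hA.integrable_angleMeasure.const_mul _)
        (Filter.Eventually.of_forall fun θ => (hAB θ η).trans_eq (by ring))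
    rw [integral_const_mul] at h4
    calc _ ≤ (k.factorial : ℝ) * (K * B η * ∫ θ, A θ ∂angleMeasure) := by gcongr
      _ = _ := by ring
  have h5 : ∫ η, ‖(dirDeriv (1, 0))^[k] H (s, t + circleMap 0 1 η)‖ ∂angleMeasure ≤
      ∫ η, (k.factorial * K * ∫ θ, A θ ∂angleMeasure) * B η ∂angleMeasure :=
    integral_mono_of_nonneg (Filter.Eventually.of_forall fun _ => norm_nonneg _)
      (hB.integrable_angleMeasure.const_mul _) (Filter.Eventually.of_forall h2)
  rw [integral_const_mul] at h5
  calc _ ≤ (j.factorial : ℝ) * ((k.factorial * K * ∫ θ, A θ ∂angleMeasure) *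
        ∫ η, B η ∂angleMeasure) := by gcongr
    _ = _ := by ring

lemma tildeE.continuous {u : ℂ → ℂ} (hu : tildeE u) : Continuous u := by
  obtain ⟨f, hf, h⟩ := hu
  have := hf.continuous
  rw [show u = _ from funext h]
  fun_prop

lemma norm_pow_mul_le (n : ℕ) (x a : ℂ) {s : ℂ} (hs : ‖s‖ ≤ 1) :
    ‖x‖ ^ n * ‖a‖ ≤ 2 ^ n * (‖a‖ + ‖(x + s) ^ n * a‖) := by
  have h1 : ‖x‖ ≤ 1 + ‖x + s‖ := by
    have := norm_sub_le (x + s) s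
    rw [add_sub_cancel_right] at this
    linarith
  have h2 : ‖x‖ ^ n ≤ 2 ^ n * (1 + ‖x + s‖ ^ n) := by
    calc ‖x‖ ^ n ≤ (1 + ‖x + s‖) ^ n := by gcongr
      _ ≤ 2 ^ (n - 1) * (1 ^ n + ‖x + s‖ ^ n) := add_pow_le zero_le_one (norm_nonneg _) n
      _ ≤ 2 ^ n * (1 + ‖x + s‖ ^ n) := by
        rw [one_pow]
        gcongr
        · norm_num
        · omega
  calc ‖x‖ ^ n * ‖a‖ ≤ 2 ^ n * (1 + ‖x + s‖ ^ n) * ‖a‖ := by gcongr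
    _ = _ := by rw [norm_mul, norm_pow]; ring

lemma norm_pow_mul_average_le (n : ℕ) (z : ℂ) {u : ℂ → ℂ} (hu : Continuous u) {τ : ℝ → ℂ}
    (hτ : Continuous τ) (hτ1 : ∀ θ, ‖τ θ‖ ≤ 1) :
    ‖z‖ ^ n * ∫ θ, ‖u (z + τ θ)‖ ∂angleMeasure ≤
      2 ^ n * ∫ θ, (‖u (z + τ θ)‖ + ‖(z + τ θ) ^ n * u (z + τ θ)‖) ∂angleMeasure := by
  rw [← integral_const_mul, ← integral_const_mul]
  refine integral_mono ?_ ?_ fun θ => norm_pow_mul_le n z _ (hτ1 θ) <;>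
    exact Continuous.integrable_angleMeasure (by fun_prop)

lemma holderTriple_two_mul (p : ℝ≥0∞) : HolderTriple (2 * p) (2 * p) p where
  inv_add_inv_eq_inv := by
    rw [ENNReal.mul_inv (by simp) (by simp), ← add_mul, ENNReal.inv_two_add_inv_two, one_mul]

/-- The pointwise smoothing estimate. -/
lemma norm_pow_mul_wirtinger_le (n m j k : ℕ) {u v : ℂ → ℂ} (hu : tildeE u) (hv : tildeE v)
    (z : ℂ) :
    ‖z ^ (n + m) * (wdb^[j] (wd^[k] (fun w => u w * (starRingEnd ℂ) (v w)))) z‖ ≤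
      (j.factorial * k.factorial * (Real.exp 2 * 2 ^ (n + m))) *
        ((∫ θ, (‖u (z + circleMap 0 1 θ)‖ +
            ‖(z + circleMap 0 1 θ) ^ n * u (z + circleMap 0 1 θ)‖) ∂angleMeasure) *
          ∫ θ, (‖v (z + (starRingEnd ℂ) (circleMap 0 1 θ))‖ +
            ‖(z + (starRingEnd ℂ) (circleMap 0 1 θ)) ^ m *
              v (z + (starRingEnd ℂ) (circleMap 0 1 θ))‖) ∂angleMeasure) := by
  have huc := hu.continuous
  have hvc := hv.continuous
  obtain ⟨f, hf, hfu⟩ := hu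
  obtain ⟨g, hg, hgv⟩ := hv
  have hg' : Differentiable ℂ fun t => (starRingEnd ℂ) (g ((starRingEnd ℂ) t)) :=
    fun t => differentiableAt_conj_conj_iff.2 (hg ((starRingEnd ℂ) t))
  set H : ℂ × ℂ → ℂ := fun p =>
    f p.1 * (starRingEnd ℂ) (g ((starRingEnd ℂ) p.2)) * exp (-(p.1 * p.2)) with hHdef
  have hH : ContDiff ℂ (⊤ : ℕ∞) H :=
    ((hf.contDiff.comp contDiff_fst).mul (hg'.contDiff.comp contDiff_snd)).mul
      (contDiff_fst.mul contDiff_snd).neg.cexp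
  have huv : (fun w => u w * (starRingEnd ℂ) (v w)) = fun w => H (w, (starRingEnd ℂ) w) := by
    funext w
    simp only [hHdef, hfu, hgv, map_mul, ← exp_conj, conj_conj, map_div₀, map_neg, conj_ofReal,
      mul_conj, map_ofNat]
    rw [mul_mul_mul_comm, ← exp_add, ← normSq_eq_norm_sq]
    congr 2
    ring
  have hnorm : ∀ a b : ℂ, ‖H (a, (starRingEnd ℂ) b)‖ =
      ‖u a‖ * ‖v b‖ * Real.exp (‖a - b‖ ^ 2 / 2) := fun a b => by
    simp only [hHdef, hfu, hgv, norm_mul, conj_conj, norm_conj, norm_exp]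
    have h1 : ∀ c : ℂ, (-((‖c‖ ^ 2 : ℝ) : ℂ) / 2).re = -‖c‖ ^ 2 / 2 := fun c => by
      rw [← ofReal_neg, ← Complex.ofReal_ofNat, ← ofReal_div, ofReal_re]
    rw [h1, h1]
    have h2 : (-(a * (starRingEnd ℂ) b)).re = -‖a‖ ^ 2 / 2 + -‖b‖ ^ 2 / 2 + ‖a - b‖ ^ 2 / 2 := by
      simp only [← normSq_eq_norm_sq, normSq_apply, neg_re, mul_re, conj_re, conj_im, sub_re,
        sub_im]
      ring
    rw [h2, Real.exp_add, Real.exp_add]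
    ring
  have hcirc : ∀ θ, ‖circleMap 0 1 θ‖ = 1 := fun θ => by simp
  have hτ : Continuous (circleMap 0 1) := continuous_circleMap 0 1
  have hτ' : Continuous fun θ => (starRingEnd ℂ) (circleMap 0 1 θ) := continuous_conj.comp hτ
  have hbd : ∀ θ η, ‖H (z + circleMap 0 1 θ, (starRingEnd ℂ) z + circleMap 0 1 η)‖ ≤
      Real.exp 2 * (‖u (z + circleMap 0 1 θ)‖ *
        ‖v (z + (starRingEnd ℂ) (circleMap 0 1 η))‖) := fun θ η => by
    have h1 := hnorm (z + circleMap 0 1 θ) (z + (starRingEnd ℂ) (circleMap 0 1 η))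
    rw [map_add, conj_conj] at h1
    rw [h1, mul_comm, add_sub_add_left_eq_sub]
    gcongr
    have h2 := norm_sub_le (circleMap 0 1 θ) ((starRingEnd ℂ) (circleMap 0 1 η))
    rw [norm_conj, hcirc, hcirc] at h2
    nlinarith [norm_nonneg (circleMap 0 1 θ - (starRingEnd ℂ) (circleMap 0 1 η))]
  have hmain := norm_mixed_dirDeriv_le hH j k z ((starRingEnd ℂ) z)
    (A := fun θ => ‖u (z + circleMap 0 1 θ)‖)
    (B := fun η => ‖v (z + (starRingEnd ℂ) (circleMap 0 1 η))‖)
    (by fun_prop) (by fun_prop) hbd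
  have hu1 := norm_pow_mul_average_le n z huc hτ fun θ => (hcirc θ).le
  have hv1 := norm_pow_mul_average_le m z hvc hτ' fun θ => by rw [norm_conj, hcirc]
  rw [huv, iterate_wd_antidiagonal hH, iterate_wdb_antidiagonal (hH.iterate_dirDeriv _ k),
    norm_mul, norm_pow, pow_add]
  calc _ ≤ ‖z‖ ^ n * ‖z‖ ^ m * _ := mul_le_mul_of_nonneg_left hmain (by positivity)
    _ = (j.factorial * k.factorial * Real.exp 2) *
        ((‖z‖ ^ n * ∫ θ, ‖u (z + circleMap 0 1 θ)‖ ∂angleMeasure) *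
          (‖z‖ ^ m * ∫ θ, ‖v (z + (starRingEnd ℂ) (circleMap 0 1 θ))‖ ∂angleMeasure)) := by
        ring
    _ ≤ (j.factorial * k.factorial * Real.exp 2) * (_ * _) := by
        refine mul_le_mul_of_nonneg_left (mul_le_mul hu1 hv1 (by positivity) ?_) (by positivity)
        exact le_trans (by positivity) hu1
    _ = _ := by ring

lemma eLpNorm_weight_average_le {u : ℂ → ℂ} (hu : Continuous u) {τ : ℝ → ℂ} (hτ : Continuous τ)
    (n : ℕ) {q : ℝ≥0∞} (hq : 1 ≤ q) :
    eLpNorm (fun z => ∫ θ, (‖u (z + τ θ)‖ + ‖(z + τ θ) ^ n * u (z + τ θ)‖) ∂angleMeasure) q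
        volume ≤
      eLpNorm u q volume + eLpNorm (fun z => z ^ n * u z) q volume := by
  have h1 : Continuous fun z => ‖u z‖ := by fun_prop
  have h2 : Continuous fun z => ‖z ^ n * u z‖ := by fun_prop
  refine (eLpNorm_average_translate_le (h1.add h2) hτ hq).trans ?_
  refine (eLpNorm_add_le h1.aestronglyMeasurable h2.aestronglyMeasurable hq).trans_eq ?_
  rw [eLpNorm_norm, eLpNorm_norm]

lemma continuous_average_translate {U : ℂ → ℝ} (hU : Continuous U) {τ : ℝ → ℂ}
    (hτ : Continuous τ) : Continuous fun z => ∫ θ, U (z + τ θ) ∂angleMeasure := by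
  have h : Continuous fun z => ∫ θ in 0..2 * Real.pi, U (z + τ θ) :=
    intervalIntegral.continuous_parametric_intervalIntegral_of_continuous'
      (f := fun z θ => U (z + τ θ)) (by unfold Function.uncurry; fun_prop) _ _
  simp only [integral_angleMeasure]
  exact continuous_const.mul h

lemma eLpNorm_wirtinger_le (n m j k : ℕ) {p : ℝ≥0∞} (hp : 1 ≤ p) {u v : ℂ → ℂ}
    (hu : tildeE u) (hv : tildeE v) :
    eLpNorm (fun z : ℂ =>
        z ^ (n + m) * (wdb^[j] (wd^[k] (fun w => u w * (starRingEnd ℂ) (v w)))) z) p volume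
      ≤ ENNReal.ofReal (j.factorial * k.factorial * (Real.exp 2 * 2 ^ (n + m)))
        * (eLpNorm u (2 * p) volume + eLpNorm (fun z : ℂ => z ^ n * u z) (2 * p) volume)
        * (eLpNorm v (2 * p) volume + eLpNorm (fun z : ℂ => z ^ m * v z) (2 * p) volume) := by
  have huc := hu.continuous
  have hvc := hv.continuous
  have hτ : Continuous (circleMap 0 1) := continuous_circleMap 0 1
  have hτ' : Continuous fun θ => (starRingEnd ℂ) (circleMap 0 1 θ) := continuous_conj.comp hτ
  have hq : 1 ≤ 2 * p := hp.trans (by rw [two_mul]; exact le_self_add)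
  have := holderTriple_two_mul p
  refine (eLpNorm_mono_real (norm_pow_mul_wirtinger_le n m j k hu hv)).trans ?_
  set c : ℝ := j.factorial * k.factorial * (Real.exp 2 * 2 ^ (n + m))
  have hc0 : 0 ≤ c := by positivity
  clear_value c
  refine (eLpNorm_le_eLpNorm_mul_eLpNorm_of_nnnorm (p := 2 * p) (q := 2 * p)
    (continuous_average_translate (U := fun z => ‖u z‖ + ‖z ^ n * u z‖)
      (by fun_prop) hτ).aestronglyMeasurable
    (continuous_average_translate (U := fun z => ‖v z‖ + ‖z ^ m * v z‖)
      (by fun_prop) hτ').aestronglyMeasurable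
    (fun a b => c * (a * b)) c.toNNReal
    (Filter.Eventually.of_forall fun z => ?_)).trans ?_
  · rw [nnnorm_mul c, nnnorm_mul, mul_assoc, ← Real.toNNReal_eq_nnnorm_of_nonneg hc0]
  · gcongr
    · exact le_rfl
    · exact eLpNorm_weight_average_le huc hτ n hq
    · exact eLpNorm_weight_average_le hvc hτ' m hq

/-- Smoothing: ‖z^{n+m} ∂_z̄^j ∂_z^k (u v̄)‖_{L^p} ≤ C(‖u‖_{L^{2p}}+‖zⁿu‖_{L^{2p}})(‖v‖_{L^{2p}}+‖z^m v‖_{L^{2p}}),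
and in particular ‖∂_z̄^j ∂_z^k(|v|²)‖_{L^p} ≤ C‖v‖²_{L^{2p}}. -/
theorem stmt4 (n m j k : ℕ) :
    ∃ C : ℝ, 0 < C ∧
      (∀ p : ℝ≥0∞, 1 ≤ p → ∀ u v : ℂ → ℂ, tildeE u → tildeE v →
        eLpNorm (fun z : ℂ =>
            z ^ (n + m) * (wdb^[j] (wd^[k] (fun w => u w * (starRingEnd ℂ) (v w)))) z) p volume
          ≤ ENNReal.ofReal C
            * (eLpNorm u (2 * p) volume + eLpNorm (fun z : ℂ => z ^ n * u z) (2 * p) volume)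
            * (eLpNorm v (2 * p) volume + eLpNorm (fun z : ℂ => z ^ m * v z) (2 * p) volume))
      ∧ ∀ p : ℝ≥0∞, 1 ≤ p → ∀ v : ℂ → ℂ, tildeE v →
          eLpNorm (fun z : ℂ =>
              (wdb^[j] (wd^[k] (fun w => ((‖v w‖ ^ 2 : ℝ) : ℂ)))) z) p volume
            ≤ ENNReal.ofReal C * eLpNorm v (2 * p) volume ^ 2 := by
  refine ⟨4 * (j.factorial * k.factorial * (Real.exp 2 * 2 ^ (n + m))), by positivity, ?_, ?_⟩
  · intro p hp u v hu hv
    refine (eLpNorm_wirtinger_le n m j k hp hu hv).trans ?_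
    have : (0 : ℝ) ≤ j.factorial * k.factorial * (Real.exp 2 * 2 ^ (n + m)) := by positivity
    gcongr ENNReal.ofReal ?_ * _ * _
    linarith
  · intro p hp v hv
    have h := eLpNorm_wirtinger_le 0 0 j k hp hv hv
    simp only [add_zero, pow_zero, one_mul, mul_one, mul_conj, normSq_eq_norm_sq] at h
    refine h.trans ?_
    rw [mul_assoc, ← two_mul]
    calc _ = ENNReal.ofReal (4 * (j.factorial * k.factorial * Real.exp 2)) *
          eLpNorm v (2 * p) volume ^ 2 := by
          rw [ENNReal.ofReal_mul (p := 4) (by norm_num), ENNReal.ofReal_ofNat]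
          ring
      _ ≤ _ := by
          gcongr
          exact le_mul_of_one_le_right (Real.exp_pos 2).le (one_le_pow₀ one_le_two)
end
end

section
/- For u ∈ Ẽ and k ∈ ℕ, Π(|z|^{2k} u) = (∂_z + z̄/2)^k (z^k u). -/
open MeasureTheory Complex

noncomputable section

/-- The operator ∂_z + z̄/2. -/
def Dop (f : ℂ → ℂ) (z : ℂ) : ℂ := wd f z + (starRingEnd ℂ) z / 2 * f z

lemma Dop_mul_gaussian {h : ℂ → ℂ} (hh : Differentiable ℂ h) :
    Dop (fun z => h z * Complex.exp (-((‖z‖ ^ 2 : ℝ) : ℂ) / 2))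
      = fun z => deriv h z * Complex.exp (-((‖z‖ ^ 2 : ℝ) : ℂ) / 2) := by
  funext z
  have h₁ := (hh z).hasDerivAt.complexToReal_fderiv
  have h₂ := (hasStrictFDerivAt_norm_sq z).hasFDerivAt
  have h₃ := (Complex.ofRealCLM.hasFDerivAt.comp z h₂).neg.mul_const ((1 : ℂ) / 2)
  have h₄ := h₁.mul h₃.cexp
  have h₅ := h₄.congr_of_eventuallyEq
    (f₁ := fun z => h z * Complex.exp (-((‖z‖ ^ 2 : ℝ) : ℂ) / 2))
    (Filter.Eventually.of_forall fun w => by simp [div_eq_mul_inv])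
  have hz : (starRingEnd ℂ) z = z.re - z.im * Complex.I := by
    apply Complex.ext <;> simp
  simp only [Dop, wd, h₅.fderiv, hz]
  simp [Complex.inner, div_eq_mul_inv]
  ring_nf
  simp only [Complex.I_sq]
  ring

lemma Dop_iterate_mul_gaussian (k : ℕ) {h : ℂ → ℂ} (hh : Differentiable ℂ h) :
    Dop^[k] (fun z => h z * Complex.exp (-((‖z‖ ^ 2 : ℝ) : ℂ) / 2))
      = fun z => iteratedDeriv k h z * Complex.exp (-((‖z‖ ^ 2 : ℝ) : ℂ) / 2) := by
  induction k generalizing h with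
  | zero => simp
  | succ k ih =>
    rw [Function.iterate_succ_apply, Dop_mul_gaussian hh, ih hh.deriv, iteratedDeriv_succ']

lemma integral_angle_conj_pow_mul {g : ℂ → ℂ} (hg : Differentiable ℂ g) (m : ℕ) {r : ℝ}
    (hr : 0 < r) :
    ∫ θ in Set.Ioo (-Real.pi) Real.pi,
        (starRingEnd ℂ) (Complex.polarCoord.symm (r, θ)) ^ m * g (Complex.polarCoord.symm (r, θ))
      = 2 * Real.pi / m.factorial * r ^ (2 * m) * iteratedDeriv m g 0 := by
  have hpolar : ∀ θ : ℝ, Complex.polarCoord.symm (r, θ) = circleMap 0 r θ := fun θ => by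
    simp [circleMap, Complex.exp_mul_I]
  have hcauchy := DifferentiableOn.circleIntegral_one_div_sub_center_pow_smul hr m
    (hg.differentiableOn (s := Metric.closedBall 0 r))
  have hper : Function.Periodic
      (fun θ : ℝ => (starRingEnd ℂ) (circleMap 0 r θ) ^ m * g (circleMap 0 r θ))
      (2 * Real.pi) := fun θ => by simp only [periodic_circleMap 0 r θ]
  have hshift := hper.intervalIntegral_add_eq (-Real.pi) 0
  rw [zero_add, show -Real.pi + 2 * Real.pi = Real.pi by ring] at hshift
  simp only [hpolar]
  rw [← integral_Ioc_eq_integral_Ioo,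
    ← intervalIntegral.integral_of_le (by linarith [Real.pi_pos]), hshift]
  have hpt : ∀ θ : ℝ, (starRingEnd ℂ) (circleMap 0 r θ) ^ m * g (circleMap 0 r θ)
      = ((r : ℂ) ^ (2 * m) / Complex.I) * (deriv (circleMap 0 r) θ •
        ((1 / (circleMap 0 r θ - 0) ^ (m + 1)) • g (circleMap 0 r θ))) := fun θ => by
    have hne : circleMap 0 r θ ≠ 0 := circleMap_ne_center hr.ne'
    have hconj : (starRingEnd ℂ) (circleMap 0 r θ) * circleMap 0 r θ = (r : ℂ) ^ 2 := by
      rw [mul_comm, Complex.mul_conj, Complex.normSq_eq_norm_sq]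
      simp
    rw [eq_div_of_mul_eq hne hconj]
    simp only [deriv_circleMap, smul_eq_mul, sub_zero, pow_mul, div_pow]
    field_simp
    ring
  simp only [hpt]
  rw [intervalIntegral.integral_const_mul]
  rw [circleIntegral] at hcauchy
  rw [hcauchy, smul_eq_mul]
  field_simp

lemma integral_Ioi_pow_mul_exp_neg_sq (m : ℕ) :
    ∫ r in Set.Ioi (0 : ℝ), r ^ (2 * m + 1) * Real.exp (-r ^ 2) = m.factorial / 2 := by
  have h := integral_rpow_mul_exp_neg_rpow (p := 2) (q := ((2 * m + 1 : ℕ) : ℝ)) two_pos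
    (by push_cast; linarith [(Nat.cast_nonneg m : (0 : ℝ) ≤ m)])
  rw [show ((((2 * m + 1 : ℕ) : ℝ)) + 1) / 2 = m + 1 by push_cast; ring,
    Real.Gamma_nat_eq_factorial] at h
  simp only [Real.rpow_natCast, Real.rpow_two] at h
  rw [h]
  ring

lemma integrableOn_polarCoord_symm {F : ℂ → ℂ} (hF : Integrable F) (hc : Continuous F) :
    IntegrableOn (fun p : ℝ × ℝ => p.1 • F (Complex.polarCoord.symm p)) polarCoord.target := by
  refine ⟨Continuous.aestronglyMeasurable ?_, ?_⟩
  · simp only [Complex.polarCoord_symm_apply]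
    fun_prop
  · have h := hF.2
    rw [hasFiniteIntegral_iff_enorm, ← Complex.lintegral_comp_polarCoord_symm] at h
    rw [hasFiniteIntegral_iff_enorm]
    refine lt_of_eq_of_lt
      (setLIntegral_congr_fun polarCoord.open_target.measurableSet fun p hp => ?_) h
    have hp' : 0 ≤ p.1 := le_of_lt hp.1
    simp only [enorm_smul, smul_eq_mul, Real.enorm_of_nonneg hp']

lemma integral_conj_pow_mul_gaussian {g : ℂ → ℂ} (hg : Differentiable ℂ g) (m : ℕ)
    (hi : Integrable fun w : ℂ => (starRingEnd ℂ) w ^ m * g w * (Real.exp (-‖w‖ ^ 2) : ℂ)) :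
    ∫ w : ℂ, (starRingEnd ℂ) w ^ m * g w * (Real.exp (-‖w‖ ^ 2) : ℂ)
      = Real.pi * iteratedDeriv m g 0 := by
  have hgc := hg.continuous
  have hpol := integrableOn_polarCoord_symm hi (by fun_prop)
  rw [← Complex.integral_comp_polarCoord_symm, polarCoord_target, Measure.volume_eq_prod,
    setIntegral_prod _ hpol]
  have hinner : ∀ r ∈ Set.Ioi (0 : ℝ), ∫ θ in Set.Ioo (-Real.pi) Real.pi,
      r • ((starRingEnd ℂ) (Complex.polarCoord.symm (r, θ)) ^ m *
        g (Complex.polarCoord.symm (r, θ)) *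
        (Real.exp (-‖Complex.polarCoord.symm (r, θ)‖ ^ 2) : ℂ))
      = ((r ^ (2 * m + 1) * Real.exp (-r ^ 2) : ℝ) : ℂ) *
        (2 * Real.pi / m.factorial * iteratedDeriv m g 0) := fun r hr => by
    simp only [Complex.norm_polarCoord_symm, sq_abs]
    rw [integral_smul, integral_mul_const, integral_angle_conj_pow_mul hg m hr,
      Complex.real_smul]
    push_cast
    ring
  rw [setIntegral_congr_fun measurableSet_Ioi hinner, integral_mul_const, integral_complex_ofReal,
    integral_Ioi_pow_mul_exp_neg_sq]
  have : (m.factorial : ℂ) ≠ 0 := by exact_mod_cast m.factorial_ne_zero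
  push_cast
  field_simp

lemma integral_exp_conj_mul_gaussian {g : ℂ → ℂ} (hg : Differentiable ℂ g) (k : ℕ)
    (hi : ∀ R : ℝ, 0 < R → Integrable
      fun w : ℂ => Real.exp (R * ‖w‖) * (‖w‖ ^ k * ‖g w‖ * Real.exp (-‖w‖ ^ 2))) (z : ℂ) :
    ∫ w : ℂ, Complex.exp ((starRingEnd ℂ) w * z) *
        ((starRingEnd ℂ) w ^ k * g w * (Real.exp (-‖w‖ ^ 2) : ℂ))
      = Real.pi * iteratedDeriv k g z := by
  have hgc := hg.continuous
  have hmoment : ∀ n : ℕ, Integrable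
      fun w : ℂ => (starRingEnd ℂ) w ^ (n + k) * g w * (Real.exp (-‖w‖ ^ 2) : ℂ) := fun n => by
    refine ((hi 1 one_pos).const_mul (n.factorial : ℝ)).mono'
      (Continuous.aestronglyMeasurable (by fun_prop)) (Filter.Eventually.of_forall fun w => ?_)
    have h := Real.pow_div_factorial_le_exp ‖w‖ (norm_nonneg w) n
    rw [div_le_iff₀ (by positivity)] at h
    rw [norm_mul, norm_mul, norm_pow, RCLike.norm_conj, Complex.norm_real,
      Real.norm_of_nonneg (Real.exp_pos _).le, pow_add, one_mul]
    calc ‖w‖ ^ n * ‖w‖ ^ k * ‖g w‖ * Real.exp (-‖w‖ ^ 2)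
        = ‖w‖ ^ n * (‖w‖ ^ k * ‖g w‖ * Real.exp (-‖w‖ ^ 2)) := by ring
      _ ≤ Real.exp ‖w‖ * n.factorial * (‖w‖ ^ k * ‖g w‖ * Real.exp (-‖w‖ ^ 2)) := by gcongr
      _ = _ := by ring
  have hbound : ∀ w : ℂ, HasSum
      (fun n : ℕ => (‖w‖ * ‖z‖) ^ n / n.factorial * (‖w‖ ^ k * ‖g w‖ * Real.exp (-‖w‖ ^ 2)))
      (Real.exp (‖w‖ * ‖z‖) * (‖w‖ ^ k * ‖g w‖ * Real.exp (-‖w‖ ^ 2))) := fun w => by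
    rw [Real.exp_eq_exp_ℝ]
    exact (NormedSpace.expSeries_div_hasSum_exp (‖w‖ * ‖z‖)).mul_right _
  have hsum := hasSum_integral_of_dominated_convergence (μ := (volume : Measure ℂ))
    (F := fun (n : ℕ) (w : ℂ) => ((starRingEnd ℂ) w * z) ^ n / n.factorial *
      ((starRingEnd ℂ) w ^ k * g w * (Real.exp (-‖w‖ ^ 2) : ℂ)))
    (f := fun w => Complex.exp ((starRingEnd ℂ) w * z) *
      ((starRingEnd ℂ) w ^ k * g w * (Real.exp (-‖w‖ ^ 2) : ℂ)))
    (fun n w => (‖w‖ * ‖z‖) ^ n / n.factorial * (‖w‖ ^ k * ‖g w‖ * Real.exp (-‖w‖ ^ 2)))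
    (fun n => Continuous.aestronglyMeasurable (by fun_prop))
    (fun n => Filter.Eventually.of_forall fun w => le_of_eq (by
      simp only [norm_mul, norm_div, norm_pow, RCLike.norm_conj, Complex.norm_real,
        Complex.norm_natCast, Real.norm_of_nonneg (Real.exp_pos _).le]))
    (Filter.Eventually.of_forall fun w => (hbound w).summable)
    (by
      simp only [fun w => (hbound w).tsum_eq]
      refine (hi (‖z‖ + 1) (by positivity)).mono' (Continuous.aestronglyMeasurable (by fun_prop))
        (Filter.Eventually.of_forall fun w => ?_)
      rw [Real.norm_of_nonneg (by positivity)]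
      exact mul_le_mul_of_nonneg_right
        (Real.exp_le_exp.2 (by nlinarith [norm_nonneg w])) (by positivity))
    (Filter.Eventually.of_forall fun w => by
      have h := NormedSpace.expSeries_div_hasSum_exp ((starRingEnd ℂ) w * z)
      rw [← Complex.exp_eq_exp_ℂ] at h
      exact h.mul_right _)
  have hterm : ∀ n : ℕ, ∫ w : ℂ, ((starRingEnd ℂ) w * z) ^ n / n.factorial *
      ((starRingEnd ℂ) w ^ k * g w * (Real.exp (-‖w‖ ^ 2) : ℂ))
      = Real.pi * ((n.factorial : ℂ)⁻¹ • (z - 0) ^ n • iteratedDeriv n (iteratedDeriv k g) 0) :=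
    fun n => by
    have hrw : ∀ w : ℂ, ((starRingEnd ℂ) w * z) ^ n / n.factorial *
        ((starRingEnd ℂ) w ^ k * g w * (Real.exp (-‖w‖ ^ 2) : ℂ))
        = z ^ n / n.factorial *
          ((starRingEnd ℂ) w ^ (n + k) * g w * (Real.exp (-‖w‖ ^ 2) : ℂ)) := fun w => by
      rw [mul_pow, pow_add]
      ring
    simp only [hrw]
    rw [integral_const_mul, integral_conj_pow_mul_gaussian hg _ (hmoment n)]
    simp only [iteratedDeriv_eq_iterate, Function.iterate_add_apply, smul_eq_mul, sub_zero]
    ring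
  simp only [hterm] at hsum
  have hdiff : Differentiable ℂ (iteratedDeriv k g) :=
    (hg.contDiff (n := ⊤)).differentiable_iteratedDeriv k (by simp)
  exact hsum.unique ((Complex.hasSum_taylorSeries_of_entire hdiff 0 z).mul_left _)

/-- Π(|z|^{2k} u) = (∂_z + z̄/2)^k (z^k u) for u ∈ Ẽ. -/
theorem stmt14 (k : ℕ) (u : ℂ → ℂ) (hu : tildeE u)
    (hint : ∀ R : ℝ, 0 < R → Integrable
      (fun w : ℂ => Real.exp (R * ‖w‖ - ‖w‖ ^ 2 / 2) * ‖w‖ ^ (2 * k) * ‖u w‖)) :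
    ∀ z : ℂ, Proj (fun w => ((‖w‖ ^ (2 * k) : ℝ) : ℂ) * u w) z
      = (Dop^[k] (fun w => w ^ k * u w)) z := by
  intro z
  obtain ⟨f, hf, hu⟩ := hu
  obtain rfl : u = fun z => f z * Complex.exp (-((‖z‖ ^ 2 : ℝ) : ℂ) / 2) := funext hu
  have hg : Differentiable ℂ fun w => w ^ k * f w := by fun_prop
  have hexp : ∀ w : ℂ, Complex.exp (-((‖w‖ ^ 2 : ℝ) : ℂ) / 2) = (Real.exp (-‖w‖ ^ 2 / 2) : ℂ) :=
    fun w => by push_cast; rfl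
  have hi : ∀ R : ℝ, 0 < R → Integrable fun w : ℂ =>
      Real.exp (R * ‖w‖) * (‖w‖ ^ k * ‖w ^ k * f w‖ * Real.exp (-‖w‖ ^ 2)) := fun R hR => by
    refine (hint R hR).congr (Filter.Eventually.of_forall fun w => ?_)
    simp only [hexp, norm_mul, norm_pow, Complex.norm_real,
      Real.norm_of_nonneg (Real.exp_pos _).le]
    rw [show -‖w‖ ^ 2 = -‖w‖ ^ 2 / 2 + -‖w‖ ^ 2 / 2 by ring, Real.exp_add,
      show R * ‖w‖ - ‖w‖ ^ 2 / 2 = R * ‖w‖ + -‖w‖ ^ 2 / 2 by ring, Real.exp_add]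
    ring_nf
  have hRHS : (fun w => w ^ k * (f w * Complex.exp (-((‖w‖ ^ 2 : ℝ) : ℂ) / 2)))
      = fun w => w ^ k * f w * Complex.exp (-((‖w‖ ^ 2 : ℝ) : ℂ) / 2) := by
    funext w
    ring
  have hLHS : ∀ w : ℂ, Complex.exp ((starRingEnd ℂ) w * z - ((‖w‖ ^ 2 : ℝ) : ℂ) / 2) *
      (((‖w‖ ^ (2 * k) : ℝ) : ℂ) * (f w * Complex.exp (-((‖w‖ ^ 2 : ℝ) : ℂ) / 2)))
      = Complex.exp ((starRingEnd ℂ) w * z) *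
        ((starRingEnd ℂ) w ^ k * (w ^ k * f w) * (Real.exp (-‖w‖ ^ 2) : ℂ)) := fun w => by
    have hnorm : ((‖w‖ ^ (2 * k) : ℝ) : ℂ) = (starRingEnd ℂ) w ^ k * w ^ k := by
      rw [← mul_pow, mul_comm ((starRingEnd ℂ) w) w, Complex.mul_conj, Complex.normSq_eq_norm_sq,
        pow_mul]
      push_cast
      rfl
    have hsq : (Real.exp (-‖w‖ ^ 2) : ℂ) = Complex.exp (-((‖w‖ ^ 2 : ℝ) : ℂ) / 2) *
        Complex.exp (-((‖w‖ ^ 2 : ℝ) : ℂ) / 2) := by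
      rw [← Complex.exp_add]
      push_cast
      ring_nf
    rw [hnorm, hsq, sub_eq_add_neg, Complex.exp_add, neg_div]
    ring
  rw [hRHS, Dop_iterate_mul_gaussian k hg]
  simp only [Proj, hLHS]
  rw [integral_exp_conj_mul_gaussian hg k hi z]
  have : (Real.pi : ℂ) ≠ 0 := by exact_mod_cast Real.pi_ne_zero
  field_simp
end
end
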